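/- Let O ⊂ ℝ² be a simple loop (the image of a continuous map γ : [0,1] → ℝ² with γ(0) = γ(1) and γ injective on [0,1)). Then ℝ² \ O has exactly two path-connected components, one bounded and one unbounded. -/

import Mathlib

open Bornology

open Complex Set

/-- Two continuous logarithms of the same function on a preconnected set differ by a constant
multiple of `2πi`. -/
theorem IsPreconnected.exists_int_eq_add_of_exp_eq {X : Type*} [TopologicalSpace X] {s : Set X}
    (hs : IsPreconnected s) {f g : X → ℂ} (hf : ContinuousOn f s) (hg : ContinuousOn g s)
    (h : ∀ x ∈ s, exp (f x) = exp (g x)) :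
    ∃ n : ℤ, ∀ x ∈ s, f x = g x + n * (2 * Real.pi * I) := by
  rcases s.eq_empty_or_nonempty with rfl | ⟨x₀, hx₀⟩
  · exact ⟨0, by simp⟩
  obtain ⟨n, hn⟩ := exp_eq_exp_iff_exists_int.1 (h x₀ hx₀)
  refine ⟨n, fun x hx ↦ ?_⟩
  have hd : IsDiscrete (AddSubgroup.zmultiples (2 * Real.pi * I) : Set ℂ) :=
    ⟨NormedSpace.discreteTopology_zmultiples _⟩
  have key := hs.constant_of_mapsTo hd (hf.sub hg) (fun y hy ↦ by
    obtain ⟨k, hk⟩ := exp_eq_exp_iff_exists_int.1 (h y hy)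
    exact ⟨k, by simp [hk]⟩) hx hx₀
  simp only [Pi.sub_apply] at key
  rw [hn] at key
  linear_combination key

/-- A function winding `a` times around the origin has a continuous logarithm along a loop only if
`a = 0`. -/
theorem eq_zero_of_exp_eq_mul_exp {L : ℝ → ℂ} (hL : Continuous L) (hper : L (2 * Real.pi) = L 0)
    {c : ℂ} {a : ℤ} (h : ∀ t : ℝ, exp (L t) = c * exp (a * (t * I))) : a = 0 := by
  obtain ⟨n, hn⟩ := isPreconnected_univ.exists_int_eq_add_of_exp_eq (s := univ)
    (f := fun t : ℝ ↦ L t - a * (t * I)) (g := fun _ ↦ L 0) (by fun_prop) (by fun_prop)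
    (fun t _ ↦ by
      have h0 := h 0
      simp only [ofReal_zero, zero_mul, mul_zero, exp_zero, mul_one] at h0
      rw [exp_sub, h, h0, mul_div_cancel_right₀ _ (exp_ne_zero _)])
  have h1 := hn 0 trivial
  have h2 := hn (2 * Real.pi) trivial
  rw [hper] at h2
  push_cast at h1 h2
  have h3 : (a : ℂ) * (2 * Real.pi * I) = 0 := by linear_combination h1 - h2
  simpa [Real.pi_ne_zero] using h3

/-- A nowhere vanishing path in `ℂ` has a continuous logarithm. -/
theorem exists_exp_eq_of_path (f : C(unitInterval, ℂ)) (hf : ∀ t, f t ≠ 0) :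
    ∃ g : C(unitInterval, ℂ), ∀ t, exp (g t) = f t := by
  obtain ⟨g, hg, -⟩ := isCoveringMap_exp.exists_path_lifts
    ⟨fun t ↦ ⟨f t, hf t⟩, by fun_prop⟩ (log (f 0)) (Subtype.ext (exp_log (hf 0)).symm)
  exact ⟨g, fun t ↦ congrArg Subtype.val (congrFun hg t)⟩

/-- A nowhere vanishing continuous function on the plane has a continuous logarithm. -/
theorem exists_exp_eq_of_continuous (f : C(ℂ, ℂ)) (hf : ∀ z, f z ≠ 0) :
    ∃ g : C(ℂ, ℂ), ∀ z, exp (g z) = f z := by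
  obtain ⟨g, ⟨-, hg⟩, -⟩ := isCoveringMapOn_exp.existsUnique_continuousMap_lifts f
    (exp_log (hf 0)) (fun z ↦ hf z)
  exact ⟨g, fun z ↦ congrFun hg z⟩

/-- The function `(z - α 1) / (z - α 0)` has a continuous logarithm off the path `α`. -/
theorem exists_log_div_compl_range (α : C(unitInterval, ℂ)) :
    ∃ g : ℂ → ℂ, ContinuousOn g (range α)ᶜ ∧
      ∀ z ∈ (range α)ᶜ, exp (g z) = (z - α 1) / (z - α 0) := by
  classical
  have hne (t : unitInterval) (z : ((range α)ᶜ : Set ℂ)) : (z : ℂ) - α t ≠ 0 :=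
    sub_ne_zero.2 fun h ↦ z.2 ⟨t, h.symm⟩
  let H : C(unitInterval × ((range α)ᶜ : Set ℂ), {z : ℂ // z ≠ 0}) :=
    ⟨fun p ↦ ⟨(p.2 - α p.1) / (p.2 - α 0), div_ne_zero (hne _ _) (hne _ _)⟩,
      Continuous.subtype_mk (Continuous.div (by fun_prop) (by fun_prop) fun p ↦ hne _ _) _⟩
  have h0 (z) : H (0, z) = ⟨exp ((0 : C(((range α)ᶜ : Set ℂ), ℂ)) z), exp_ne_zero _⟩ :=
    Subtype.ext (by simp [H, div_self (hne 0 z)])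
  have hlift := isCoveringMap_exp.liftHomotopy_lifts H 0 h0
  set G := isCoveringMap_exp.liftHomotopy H 0 h0
  refine ⟨fun z ↦ if hz : z ∈ (range α)ᶜ then G (1, ⟨z, hz⟩) else 0, ?_, fun z hz ↦ ?_⟩
  · rw [continuousOn_iff_continuous_domRestrict]
    have : Continuous fun z : ((range α)ᶜ : Set ℂ) ↦ G (1, z) := by fun_prop
    convert this using 2 with z
    exact dif_pos z.2
  · simp only [dif_pos hz]
    exact congrArg Subtype.val (congrFun hlift (1, ⟨z, hz⟩))

/-- Two arcs with the same distinct endpoints, which meet only there, together separate the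
plane. -/
theorem not_isPreconnected_compl_union_range {α β : C(unitInterval, ℂ)} (h0 : α 0 = β 0)
    (h1 : α 1 = β 1) (hne : α 0 ≠ α 1) (hinter : range α ∩ range β ⊆ {α 0, α 1}) :
    ¬ IsPreconnected (range α ∪ range β)ᶜ := by
  classical
  intro hconn
  obtain ⟨f, hfc, hf⟩ := exists_log_div_compl_range α
  obtain ⟨g, hgc, hg⟩ := exists_log_div_compl_range β
  rw [← h0, ← h1] at hg
  rw [compl_union] at hconn
  obtain ⟨n, hn⟩ := hconn.exists_int_eq_add_of_exp_eq (hfc.mono inter_subset_left)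
    (hgc.mono inter_subset_right) fun z hz ↦ (hf z hz.1).trans (hg z hz.2).symm
  have hA : IsOpen (range α)ᶜ := (isCompact_range α.continuous).isClosed.isOpen_compl
  have hB : IsOpen (range β)ᶜ := (isCompact_range β.continuous).isClosed.isOpen_compl
  let F : ℂ → ℂ := (range α)ᶜ.piecewise f fun z ↦ g z + n * (2 * Real.pi * I)
  have hFA : EqOn F f (range α)ᶜ := piecewise_eqOn _ _ _
  have hFB : EqOn F (fun z ↦ g z + n * (2 * Real.pi * I)) (range β)ᶜ := fun z hz ↦ by
    by_cases hzA : z ∈ (range α)ᶜ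
    · rw [hFA hzA, hn z ⟨hzA, hz⟩]
    · exact piecewise_eq_of_notMem _ _ _ hzA
  have hcases (z : ℂ) (hz : z ∉ ({α 0, α 1} : Set ℂ)) : z ∈ (range α)ᶜ ∨ z ∈ (range β)ᶜ := by
    by_contra! h
    exact hz (hinter ⟨not_not.1 h.1, not_not.1 h.2⟩)
  have hFc (z : ℂ) (hz : z ∉ ({α 0, α 1} : Set ℂ)) : ContinuousAt F z := by
    rcases hcases z hz with h | h
    · exact (hfc.congr hFA).continuousAt (hA.mem_nhds h)
    · exact ((hgc.add continuousOn_const).congr hFB).continuousAt (hB.mem_nhds h)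
  have hFexp (z : ℂ) (hz : z ∉ ({α 0, α 1} : Set ℂ)) :
      exp (F z) = (z - α 1) / (z - α 0) := by
    rcases hcases z hz with h | h
    · rw [hFA h, hf z h]
    · rw [hFB h, exp_add, exp_int_mul_two_pi_mul_I, mul_one, hg z h]
  generalize α 0 = p at *
  generalize α 1 = q at *
  have hd : q - p ≠ 0 := sub_ne_zero.2 hne.symm
  have hmem (t : ℝ) : 1 + exp (t * I) / 2 ∈ slitPlane :=
    mem_slitPlane_of_norm_lt_one (by simp [norm_exp_ofReal_mul_I]; norm_num)
  have hmem' (t : ℝ) : q + (q - p) * (exp (t * I) / 2) ∉ ({p, q} : Set ℂ) := by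
    rintro (h | h)
    · apply slitPlane_ne_zero (hmem t)
      apply mul_left_cancel₀ hd
      linear_combination h
    · rw [mem_singleton_iff, add_eq_left] at h
      simp [hd] at h
  refine one_ne_zero (eq_zero_of_exp_eq_mul_exp
    (L := fun t : ℝ ↦ F (q + (q - p) * (exp (t * I) / 2)) + log (1 + exp (t * I) / 2))
    (c := 1 / 2) (a := 1) ?_ ?_ fun t ↦ ?_)
  · refine .add (continuous_iff_continuousAt.2 fun t ↦ ?_) (.clog (by fun_prop) hmem)
    exact ContinuousAt.comp (f := fun t : ℝ ↦ q + (q - p) * (exp (t * I) / 2))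
      (hFc _ (hmem' t)) (by fun_prop)
  · simp
  · have h1 := slitPlane_ne_zero (hmem t)
    rw [exp_add, exp_log h1, hFexp _ (hmem' t)]
    have h2 : q + (q - p) * (exp (t * I) / 2) - p = (q - p) * (1 + exp (t * I) / 2) := by ring
    rw [h2, add_sub_cancel_left, mul_div_mul_left _ _ hd, div_mul_cancel₀ _ h1]
    simp only [Int.cast_one, one_mul]
    ring

/-- Let `x` and `y` lie off a closed set `J`, in different path components of its complement, that
of `x` being bounded. Then `(z - x) ^ a * (z - y) ^ b` has a continuous logarithm on `J` only if
`a = 0`. -/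
theorem eq_zero_of_exp_eq_zpow_mul_zpow {J : Set ℂ} (hJ : IsClosed J) {x y : ℂ} (hx : x ∉ J)
    (hy : y ∉ J) (hxy : ¬ JoinedIn Jᶜ x y) (hb : IsBounded (pathComponentIn Jᶜ x)) {a b : ℤ}
    {G : C(ℂ, ℂ)} (hG : ∀ z ∈ J, exp (G z) = (z - x) ^ a * (z - y) ^ b) : a = 0 := by
  classical
  set U := pathComponentIn Jᶜ x
  have hUo : IsOpen U := hJ.isOpen_compl.pathComponentIn x
  have hxU : x ∈ U := mem_pathComponentIn_self hx
  have hfr : closure U ⊆ U ∪ J := fun z hz ↦ by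
    by_contra! h
    rw [mem_union, not_or] at h
    obtain ⟨w, hw, hwU⟩ := mem_closure_iff.1 hz _ (hJ.isOpen_compl.pathComponentIn z)
      (mem_pathComponentIn_self h.2)
    exact h.1 (JoinedIn.trans hwU (JoinedIn.symm hw))
  have hyU : y ∉ closure U := fun h ↦ (hfr h).elim hxy hy
  have hyJ (z : ℂ) (hz : z ∈ closure U) : z - y ≠ 0 := sub_ne_zero.2 fun h ↦ hyU (h ▸ hz)
  have hxJ (z : ℂ) (hz : z ∉ U) : z - x ≠ 0 := sub_ne_zero.2 fun h ↦ hz (h ▸ hxU)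
  let F : C(ℂ, ℂ) := ⟨U.piecewise (fun z ↦ exp (G z) * (z - y) ^ (-b)) fun z ↦ (z - x) ^ a, by
    refine continuous_piecewise (fun z hz ↦ ?_) (fun z hz ↦ ?_) fun z hz ↦ ?_
    · have hzJ : z ∈ J := (hfr hz.1).resolve_left fun h ↦ hz.2 (hUo.interior_eq.symm ▸ h)
      rw [hG z hzJ, zpow_neg, mul_inv_cancel_right₀ (zpow_ne_zero _ (hyJ z hz.1))]
    · exact ((by fun_prop : ContinuousAt (fun z ↦ exp (G z)) z).mul
        (ContinuousAt.zpow₀ (f := (· - y)) (by fun_prop) (-b) (.inl (hyJ z hz)))).continuousWithinAt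
    · rw [hUo.isClosed_compl.closure_eq] at hz
      exact (ContinuousAt.zpow₀ (f := (· - x)) (by fun_prop) a
        (.inl (hxJ z hz))).continuousWithinAt⟩
  have hFout (z : ℂ) (hz : z ∉ U) : F z = (z - x) ^ a :=
    if_neg hz
  have hF0 (z : ℂ) : F z ≠ 0 := by
    by_cases hz : z ∈ U
    · rw [show F z = exp (G z) * (z - y) ^ (-b) from if_pos hz]
      exact mul_ne_zero (exp_ne_zero _) (zpow_ne_zero _ (hyJ z (subset_closure hz)))
    · rw [hFout z hz]
      exact zpow_ne_zero _ (hxJ z hz)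
  obtain ⟨L, hL⟩ := exists_exp_eq_of_continuous F hF0
  obtain ⟨R, hR⟩ := hb.subset_ball x
  have hRpos : 0 < R := by simpa using hR hxU
  refine eq_zero_of_exp_eq_mul_exp (L := fun t : ℝ ↦ L (x + R * exp (t * I)))
    (c := (R : ℂ) ^ a) (by fun_prop) (by simp) fun t ↦ ?_
  rw [hL, hFout, add_sub_cancel_left, mul_zpow, ← exp_int_mul]
  intro h
  simpa [norm_exp_ofReal_mul_I, abs_of_pos hRpos] using hR h

/-- A continuous function on a path taking equal values wherever the path self-intersects descends
to the image of the path, and extends to the whole plane. -/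
theorem exists_continuousMap_comp_eq {γ ψ : C(unitInterval, ℂ)}
    (h : Function.FactorsThrough ψ γ) : ∃ G : C(ℂ, ℂ), ∀ t, G (γ t) = ψ t := by
  let p : C(unitInterval, range γ) := ⟨rangeFactorization γ, by fun_prop⟩
  have hp : Topology.IsQuotientMap p :=
    p.continuous.isClosedMap.isQuotientMap p.continuous rangeFactorization_surjective
  have hf : Function.FactorsThrough ψ p := fun s t hst ↦ h (congrArg Subtype.val hst)
  obtain ⟨G, hG⟩ := (hp.lift ψ hf).exists_restrict_eq (isCompact_range γ.continuous).isClosed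
  refine ⟨G, fun t ↦ ?_⟩
  exact (DFunLike.congr_fun hG (p t)).trans (DFunLike.congr_fun (hp.lift_comp ψ hf) t)

/-- The complement of a simple loop has at most one bounded path component. -/
theorem joinedIn_compl_range_of_isBounded {γ : C(unitInterval, ℂ)} (hloop : γ 0 = γ 1)
    (hinj : ∀ s t, γ s = γ t → s = t ∨ s = 0 ∧ t = 1 ∨ s = 1 ∧ t = 0) {x y : ℂ}
    (hx : x ∉ range γ) (hy : y ∉ range γ) (hbx : IsBounded (pathComponentIn (range γ)ᶜ x))
    (hby : IsBounded (pathComponentIn (range γ)ᶜ y)) : JoinedIn (range γ)ᶜ x y := by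
  by_contra hxy
  have hJ : IsClosed (range γ) := (isCompact_range γ.continuous).isClosed
  have hlog (w : ℂ) (hw : w ∉ range γ) : ∃ φ : C(unitInterval, ℂ),
      (∀ t, exp (φ t) = γ t - w) ∧ ∃ n : ℤ, φ 1 = φ 0 + n * (2 * Real.pi * I) := by
    obtain ⟨φ, hφ⟩ := exists_exp_eq_of_path (γ - .const _ w)
      fun t ↦ sub_ne_zero.2 fun h ↦ hw ⟨t, h⟩
    refine ⟨φ, hφ, exp_eq_exp_iff_exists_int.1 ?_⟩
    rw [hφ, hφ]
    simp [hloop]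
  obtain ⟨φ, hφ, m, hm⟩ := hlog x hx
  obtain ⟨θ, hθ, n, hn⟩ := hlog y hy
  obtain ⟨a, b, hab, hmn⟩ : ∃ a b : ℤ, (a ≠ 0 ∨ b ≠ 0) ∧ a * m + b * n = 0 := by
    by_cases h : m = 0
    · exact ⟨1, 0, by simp [h]⟩
    · exact ⟨-n, m, .inr h, by ring⟩
  let ψ : C(unitInterval, ℂ) := ⟨fun t ↦ a * φ t + b * θ t, by fun_prop⟩
  have hψ : ψ 0 = ψ 1 := by
    have : (a : ℂ) * m + b * n = 0 := mod_cast hmn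
    simp only [ψ, ContinuousMap.coe_mk, hm, hn]
    linear_combination -(2 * Real.pi * I) * this
  obtain ⟨G, hG⟩ := exists_continuousMap_comp_eq (γ := γ) (ψ := ψ) fun s t hst ↦ by
    rcases hinj s t hst with rfl | ⟨rfl, rfl⟩ | ⟨rfl, rfl⟩
    exacts [rfl, hψ, hψ.symm]
  have hGexp : ∀ z ∈ range γ, exp (G z) = (z - x) ^ a * (z - y) ^ b := by
    rintro _ ⟨t, rfl⟩
    simp only [hG, ψ, ContinuousMap.coe_mk, exp_add, exp_int_mul, hφ, hθ]
  rcases hab with ha | hb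
  · exact ha (eq_zero_of_exp_eq_zpow_mul_zpow hJ hx hy hxy hbx hGexp)
  · exact hb (eq_zero_of_exp_eq_zpow_mul_zpow hJ hy hx (fun h ↦ hxy h.symm) hby
      fun z hz ↦ (hGexp z hz).trans (mul_comm _ _))

/-- A simple loop separates the plane. -/
theorem not_isPreconnected_compl_range {γ : C(unitInterval, ℂ)} (hloop : γ 0 = γ 1)
    (hinj : ∀ s t, γ s = γ t → s = t ∨ s = 0 ∧ t = 1 ∨ s = 1 ∧ t = 0) :
    ¬ IsPreconnected (range γ)ᶜ := by
  let u : C(unitInterval, unitInterval) :=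
    ⟨fun t ↦ ⟨t / 2, by linarith [t.2.1], by linarith [t.2.2]⟩, by fun_prop⟩
  let v : C(unitInterval, unitInterval) := ⟨fun t ↦ unitInterval.symm (u t), by fun_prop⟩
  have hu (t) : (u t : ℝ) = t / 2 := rfl
  have hv (t) : (v t : ℝ) = 1 - t / 2 := rfl
  have hu0 : u 0 = 0 := Subtype.ext (by simp [hu])
  have hv0 : v 0 = 1 := Subtype.ext (by simp [hv])
  have huv1 : v 1 = u 1 := Subtype.ext (by simp only [hu, hv, Icc.coe_one]; norm_num)
  have hrange : range γ = range (γ.comp u) ∪ range (γ.comp v) := by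
    refine Subset.antisymm ?_ (union_subset (range_comp_subset_range u γ)
      (range_comp_subset_range v γ))
    rintro _ ⟨t, rfl⟩
    rcases le_total (t : ℝ) (1 / 2) with h | h
    · refine .inl ⟨⟨2 * t, by linarith [t.2.1], by linarith⟩, congrArg γ (Subtype.ext ?_)⟩
      simp only [hu]
      ring
    · refine .inr ⟨⟨2 - 2 * t, by linarith [t.2.2], by linarith⟩, congrArg γ (Subtype.ext ?_)⟩
      simp only [hv]
      ring
  rw [hrange]
  refine not_isPreconnected_compl_union_range ?_ ?_ ?_ ?_
  · simp [hu0, hv0, hloop]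
  · simp [huv1]
  · intro h
    rcases hinj _ _ h with h | ⟨-, h⟩ | ⟨h, -⟩ <;> have := congrArg Subtype.val h <;>
      norm_num [hu] at this
  · rintro _ ⟨⟨s, rfl⟩, t, ht⟩
    have hs1 := s.2.2
    have ht1 := t.2.2
    rcases hinj _ _ ht with h | ⟨h, -⟩ | ⟨-, h⟩
    · have h' := congrArg Subtype.val h
      rw [hu, hv] at h'
      have : s = 1 := Subtype.ext (by rw [Icc.coe_one]; linarith)
      exact .inr (by simp [this])
    · have h' := congrArg Subtype.val h
      rw [hv, Icc.coe_zero] at h'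
      linarith
    · exact .inl (by simp [h, hu0])

/-- The complement of a closed ball about the origin is path connected in dimension at least two. -/
theorem isPathConnected_compl_closedBall {E : Type*} [NormedAddCommGroup E] [NormedSpace ℝ E]
    (h : 1 < Module.rank ℝ E) {r : ℝ} (hr : 0 ≤ r) :
    IsPathConnected (Metric.closedBall (0 : E) r)ᶜ := by
  have hmem {x : E} : x ∈ (Metric.closedBall (0 : E) r)ᶜ ↔ r < ‖x‖ := by simp
  have hnt : Nontrivial E := (rank_pos_iff_nontrivial (R := ℝ)).1 (zero_lt_one.trans h)
  have hscale {x : E} (hx : r < ‖x‖) {c : ℝ} (hc : 1 ≤ c) :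
      JoinedIn (Metric.closedBall (0 : E) r)ᶜ x (c • x) := by
    refine JoinedIn.of_segment_subset ?_
    rintro _ ⟨s, t, hs, ht, hst, rfl⟩
    rw [hmem, smul_smul, ← add_smul, norm_smul]
    refine hx.trans_le (le_mul_of_one_le_left (norm_nonneg x) (le_trans ?_ (le_abs_self _)))
    nlinarith
  rw [isPathConnected_iff]
  refine ⟨?_, fun x hx y hy ↦ ?_⟩
  · obtain ⟨x, hx⟩ := NormedSpace.exists_lt_norm ℝ E r
    exact ⟨x, hmem.2 hx⟩
  · rw [hmem] at hx hy
    have hx0 : 0 < ‖x‖ := hr.trans_lt hx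
    have hy0 : 0 < ‖y‖ := hr.trans_lt hy
    set M := max ‖x‖ ‖y‖
    have hcx : 1 ≤ M / ‖x‖ := (one_le_div hx0).2 (le_max_left _ _)
    have hcy : 1 ≤ M / ‖y‖ := (one_le_div hy0).2 (le_max_right _ _)
    have hM : 0 ≤ M := hx0.le.trans (le_max_left _ _)
    have hsphere : JoinedIn (Metric.sphere (0 : E) M) ((M / ‖x‖) • x) ((M / ‖y‖) • y) :=
      (isPathConnected_sphere h 0 hM).joinedIn _
        (by simp [norm_smul, abs_of_nonneg hM, hx0.ne'])
        _ (by simp [norm_smul, abs_of_nonneg hM, hy0.ne'])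
    refine (hscale hx hcx).trans ((hsphere.mono fun z hz ↦ ?_).trans (hscale hy hcy).symm)
    rw [mem_sphere_zero_iff_norm] at hz
    exact hmem.2 (hz ▸ hx.trans_le (le_max_left _ _))

section UnboundedComponent

variable {E : Type*} [NormedAddCommGroup E] [NormedSpace ℝ E] {J : Set E}

/-- The complement of a bounded set has an unbounded path component. -/
theorem exists_not_isBounded_pathComponentIn_compl (h : 1 < Module.rank ℝ E)
    (hJ : IsBounded J) : ∃ x ∈ Jᶜ, ¬ IsBounded (pathComponentIn Jᶜ x) := by
  have hnt : Nontrivial E := (rank_pos_iff_nontrivial (R := ℝ)).1 (zero_lt_one.trans h)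
  obtain ⟨r, hr, hJr⟩ := hJ.subset_closedBall_lt 0 0
  have hpc := isPathConnected_compl_closedBall h hr.le
  obtain ⟨x, hx⟩ := hpc.nonempty
  refine ⟨x, fun hxJ ↦ hx (hJr hxJ), fun hb ↦ NormedSpace.unbounded_univ ℝ E ?_⟩
  rw [← union_compl_self (Metric.closedBall (0 : E) r)]
  exact Metric.isBounded_closedBall.union (hb.subset fun y hy ↦
    (hpc.joinedIn x hx y hy).mono (compl_subset_compl.2 hJr))

/-- The complement of a bounded set has at most one unbounded path component. -/
theorem joinedIn_compl_of_not_isBounded (h : 1 < Module.rank ℝ E) (hJ : IsBounded J) {x y : E}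
    (hx : ¬ IsBounded (pathComponentIn Jᶜ x)) (hy : ¬ IsBounded (pathComponentIn Jᶜ y)) :
    JoinedIn Jᶜ x y := by
  obtain ⟨r, hr, hJr⟩ := hJ.subset_closedBall_lt 0 0
  have hex {w : E} (hw : ¬ IsBounded (pathComponentIn Jᶜ w)) :
      ∃ z ∈ (Metric.closedBall (0 : E) r)ᶜ, JoinedIn Jᶜ w z := by
    by_contra! hcon
    exact hw (Metric.isBounded_closedBall.subset fun z hz ↦ not_not.1 fun hzr ↦ hcon z hzr hz)
  obtain ⟨x', hx', hxx'⟩ := hex hx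
  obtain ⟨y', hy', hyy'⟩ := hex hy
  exact (hxx'.trans (((isPathConnected_compl_closedBall h hr.le).joinedIn x' hx' y' hy').mono
    (compl_subset_compl.2 hJr))).trans hyy'.symm

/-- A bounded set that separates the space has a bounded complementary path component. -/
theorem exists_isBounded_pathComponentIn_compl (h : 1 < Module.rank ℝ E) (hJ : IsBounded J)
    (hconn : ¬ IsPreconnected Jᶜ) : ∃ x ∈ Jᶜ, IsBounded (pathComponentIn Jᶜ x) := by
  by_contra! hcon
  obtain ⟨x, hx, hxb⟩ := exists_not_isBounded_pathComponentIn_compl h hJ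
  refine hconn (IsPathConnected.isConnected ⟨x, hx, fun y hy ↦ ?_⟩).isPreconnected
  exact joinedIn_compl_of_not_isBounded h hJ hxb (hcon y hy)

end UnboundedComponent

theorem ContinuousLinearEquiv.isBounded_image_iff {E F : Type*} [NormedAddCommGroup E]
    [NormedSpace ℝ E] [NormedAddCommGroup F] [NormedSpace ℝ F] (e : E ≃L[ℝ] F) {s : Set E} :
    IsBounded (e '' s) ↔ IsBounded s := by
  refine ⟨fun h ↦ ?_, fun h ↦ e.lipschitz.isBounded_image h⟩
  simpa [image_image] using e.symm.lipschitz.isBounded_image h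

theorem Homeomorph.image_pathComponentIn {X Y : Type*} [TopologicalSpace X] [TopologicalSpace Y]
    (e : X ≃ₜ Y) {s : Set X} {x : X} (hx : x ∈ s) :
    e '' pathComponentIn s x = pathComponentIn (e '' s) (e x) := by
  ext y
  constructor
  · rintro ⟨z, hz, rfl⟩
    exact JoinedIn.map hz e.continuous
  · intro hy
    obtain ⟨z, hz, rfl⟩ := JoinedIn.target_mem hy
    exact ⟨z, (e.isInducing.joinedIn_image hx hz).1 hy, rfl⟩



theorem stmt_14 (γ : ℝ → (Fin 2 → ℝ))
    (hcont : ContinuousOn γ (Set.Icc 0 1))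
    (hloop : γ 0 = γ 1)
    (hinj : Set.InjOn γ (Set.Ico 0 1)) :
    ∃ C₁ C₂ : Set (Fin 2 → ℝ),
      (∃ x ∈ (γ '' Set.Icc 0 1)ᶜ, C₁ = {y | JoinedIn (γ '' Set.Icc 0 1)ᶜ x y}) ∧
      (∃ x ∈ (γ '' Set.Icc 0 1)ᶜ, C₂ = {y | JoinedIn (γ '' Set.Icc 0 1)ᶜ x y}) ∧
      C₁ ≠ C₂ ∧ IsBounded C₁ ∧ ¬ IsBounded C₂ ∧
      (∀ x ∈ (γ '' Set.Icc 0 1)ᶜ,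
        {y | JoinedIn (γ '' Set.Icc 0 1)ᶜ x y} = C₁ ∨
        {y | JoinedIn (γ '' Set.Icc 0 1)ᶜ x y} = C₂) := by
  set J := γ '' Icc 0 1
  let e : (Fin 2 → ℝ) ≃L[ℝ] ℂ :=
    (ContinuousLinearEquiv.finTwoArrow ℝ ℝ).trans equivRealProdCLM.symm
  let δ : C(unitInterval, ℂ) :=
    ⟨fun t ↦ e (γ t), e.continuous.comp (continuousOn_iff_continuous_domRestrict.1 hcont)⟩
  have hδJ : range δ = e '' J := by
    ext z
    simp [δ, J, Set.mem_image]
  have hδloop : δ 0 = δ 1 := by simp [δ, hloop]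
  have hδinj (s t : unitInterval) (h : δ s = δ t) : s = t ∨ s = 0 ∧ t = 1 ∨ s = 1 ∧ t = 0 := by
    have hγ : γ s = γ t := e.injective h
    have hIco {u : unitInterval} (hu : u ≠ 1) : (u : ℝ) ∈ Ico (0 : ℝ) 1 :=
      ⟨u.2.1, lt_of_le_of_ne u.2.2 fun h ↦ hu (Subtype.ext h)⟩
    have h01 : (0 : ℝ) ∈ Ico (0 : ℝ) 1 := by simp
    by_cases hs : s = 1 <;> by_cases ht : t = 1
    · exact .inl (hs.trans ht.symm)
    · refine .inr (.inr ⟨hs, Subtype.ext (hinj (hIco ht) h01 ?_)⟩)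
      rw [← hγ, hs, Icc.coe_one]
      exact hloop.symm
    · refine .inr (.inl ⟨Subtype.ext (hinj (hIco hs) h01 ?_), ht⟩)
      rw [hγ, ht, Icc.coe_one]
      exact hloop.symm
    · exact .inl (Subtype.ext (hinj (hIco hs) (hIco ht) hγ))
  have hcompl : (range δ)ᶜ = e '' Jᶜ := by rw [hδJ, image_compl_eq e.bijective]
  have hbdd {x : Fin 2 → ℝ} (hx : x ∈ Jᶜ) :
      IsBounded (pathComponentIn (range δ)ᶜ (e x)) ↔ IsBounded (pathComponentIn Jᶜ x) := by
    rw [hcompl, ← e.isBounded_image_iff]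
    exact iff_of_eq (congrArg _ (e.toHomeomorph.image_pathComponentIn hx).symm)
  have hrank : 1 < Module.rank ℝ (Fin 2 → ℝ) := by simp
  have hJ : IsBounded J := (isCompact_Icc.image_of_continuousOn hcont).isBounded
  have huniq {x y : Fin 2 → ℝ} (hx : x ∈ Jᶜ) (hy : y ∈ Jᶜ)
      (hbx : IsBounded (pathComponentIn Jᶜ x)) (hby : IsBounded (pathComponentIn Jᶜ y)) :
      JoinedIn Jᶜ x y := by
    have hmem {w : Fin 2 → ℝ} (hw : w ∈ Jᶜ) : e w ∈ (range δ)ᶜ := hcompl ▸ mem_image_of_mem e hw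
    have := joinedIn_compl_range_of_isBounded hδloop hδinj (hmem hx) (hmem hy)
      ((hbdd hx).2 hbx) ((hbdd hy).2 hby)
    rw [hcompl] at this
    exact (e.toHomeomorph.isInducing.joinedIn_image hx hy).1 this
  have hconn : ¬ IsPreconnected Jᶜ := fun h ↦ not_isPreconnected_compl_range hδloop hδinj <| by
    rw [hcompl]
    exact h.image e e.continuous.continuousOn
  obtain ⟨x, hx, hbx⟩ := exists_isBounded_pathComponentIn_compl hrank hJ hconn
  obtain ⟨y, hy, hby⟩ := exists_not_isBounded_pathComponentIn_compl hrank hJ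
  refine ⟨pathComponentIn Jᶜ x, pathComponentIn Jᶜ y, ⟨x, hx, rfl⟩, ⟨y, hy, rfl⟩,
    fun h ↦ hby (h ▸ hbx), hbx, hby, fun z hz ↦ ?_⟩
  by_cases hbz : IsBounded (pathComponentIn Jᶜ z)
  · exact .inl (pathComponentIn_congr (huniq hx hz hbx hbz))
  · exact .inr (pathComponentIn_congr (joinedIn_compl_of_not_isBounded hrank hJ hby hbz))
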